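/- On the 6-dimensional nilpotent Lie algebra 𝔥 with the complex structure J, the almost complex structure fails to be pure at the invariant level: the 2-form α = e^{13} + e^{24} is closed and J-invariant, the 2-form β = e^{24} - e^{13} is closed and J-anti-invariant, their difference α - β = 2e^{13} is exact (α - β = d(2e⁶)), and yet α is not exact. Hence the nonzero cohomology class of α is represented both by a closed J-invariant 2-form and by a closed J-anti-invariant 2-form. -/

import Mathlib

/- STATEMENT 15: On the 6-dimensional 2-step nilpotent Lie algebra `𝔥` (basis `e₁, …, e₆`,
nonzero brackets `[e₁,e₂] = -e₅`, `[e₁,e₃] = -e₆`) with the complex structure `J`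
(`Je₁ = e₂, Je₂ = -e₁, Je₃ = e₄, Je₄ = -e₃, Je₅ = e₆, Je₆ = -e₅`), the almost complex
structure fails to be pure at the invariant level: `α = e¹³ + e²⁴` is closed and
`J`-invariant, `β = e²⁴ - e¹³` is closed and `J`-anti-invariant, `α - β = 2 e¹³` is exact
(`α - β = d(2 e⁶)`), and yet `α` is not exact. -/

/-- The basis vectors `e₁, …, e₆` of `𝔥` (zero-indexed). -/
noncomputable def e (i : Fin 6) : Fin 6 → ℝ := Pi.single i 1

/-- The Lie bracket of `𝔥`: `[e₁,e₂] = -e₅`, `[e₁,e₃] = -e₆`. -/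
noncomputable def bracket (u v : Fin 6 → ℝ) : Fin 6 → ℝ :=
  -((u 0 * v 1 - v 0 * u 1) • e 4) - (u 0 * v 2 - v 0 * u 2) • e 5

/-- The complex structure `J` with `Je₁ = e₂`, `Je₂ = -e₁`, `Je₃ = e₄`, `Je₄ = -e₃`,
`Je₅ = e₆`, `Je₆ = -e₅`. -/
noncomputable def Jmap (x : Fin 6 → ℝ) : Fin 6 → ℝ :=
  ![-(x 1), x 0, -(x 3), x 2, -(x 5), x 4]

/-- The 2-form `e^{ij} = eⁱ ∧ eʲ` (zero-indexed), as a bilinear form on `𝔥`. -/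
noncomputable def eForm (i j : Fin 6) : (Fin 6 → ℝ) →ₗ[ℝ] (Fin 6 → ℝ) →ₗ[ℝ] ℝ :=
  (LinearMap.proj (R := ℝ) (φ := fun _ : Fin 6 => ℝ) i).smulRight
      (LinearMap.proj (R := ℝ) (φ := fun _ : Fin 6 => ℝ) j) -
    (LinearMap.proj (R := ℝ) (φ := fun _ : Fin 6 => ℝ) j).smulRight
      (LinearMap.proj (R := ℝ) (φ := fun _ : Fin 6 => ℝ) i)

/-- A 2-form `α` is closed when its Chevalley-Eilenberg differential
`(dα)(x,y,z) = -α([x,y],z) + α([x,z],y) - α([y,z],x)` vanishes. -/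
def IsClosed2 (α : (Fin 6 → ℝ) →ₗ[ℝ] (Fin 6 → ℝ) →ₗ[ℝ] ℝ) : Prop :=
  ∀ x y z : Fin 6 → ℝ,
    -α (bracket x y) z + α (bracket x z) y - α (bracket y z) x = 0

/-- The 2-form `α = e¹³ + e²⁴`. -/
noncomputable def alphaH : (Fin 6 → ℝ) →ₗ[ℝ] (Fin 6 → ℝ) →ₗ[ℝ] ℝ :=
  eForm 0 2 + eForm 1 3

/-- The 2-form `β = e²⁴ - e¹³`. -/
noncomputable def betaH : (Fin 6 → ℝ) →ₗ[ℝ] (Fin 6 → ℝ) →ₗ[ℝ] ℝ :=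
  eForm 1 3 - eForm 0 2

theorem eForm_apply (i j : Fin 6) (x y : Fin 6 → ℝ) :
    eForm i j x y = x i * y j - x j * y i := by
  simp [eForm]

theorem alphaH_apply (x y : Fin 6 → ℝ) :
    alphaH x y = (x 0 * y 2 - x 2 * y 0) + (x 1 * y 3 - x 3 * y 1) := by
  simp [alphaH, eForm_apply]

theorem betaH_apply (x y : Fin 6 → ℝ) :
    betaH x y = (x 1 * y 3 - x 3 * y 1) - (x 0 * y 2 - x 2 * y 0) := by
  simp [betaH, eForm_apply]

/-- The bracket takes values in the span of `e₅` and `e₆`. -/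
theorem bracket_eq_vec (x y : Fin 6 → ℝ) :
    bracket x y = ![0, 0, 0, 0, -(x 0 * y 1 - y 0 * x 1), -(x 0 * y 2 - y 0 * x 2)] := by
  funext k
  fin_cases k <;> simp [bracket, e]

theorem statement15 :
    -- `α` is closed and `J`-invariant
    IsClosed2 alphaH ∧ (∀ x y : Fin 6 → ℝ, alphaH (Jmap x) (Jmap y) = alphaH x y) ∧
    -- `β` is closed and `J`-anti-invariant
    IsClosed2 betaH ∧ (∀ x y : Fin 6 → ℝ, betaH (Jmap x) (Jmap y) = -betaH x y) ∧
    -- `α - β = 2 e¹³`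
    (alphaH - betaH = (2 : ℝ) • eForm 0 2) ∧
    -- `α - β = d(2 e⁶)` is exact
    (∀ x y : Fin 6 → ℝ, alphaH x y - betaH x y = -(2 * bracket x y 5)) ∧
    -- `α` is not exact
    ¬ ∃ γ : (Fin 6 → ℝ) →ₗ[ℝ] ℝ, ∀ x y : Fin 6 → ℝ, alphaH x y = -γ (bracket x y) := by
  refine ⟨?_, ?_, ?_, ?_, ?_, ?_, ?_⟩
  · intro x y z
    simp [alphaH_apply, bracket_eq_vec]
  · intro x y
    simp [alphaH_apply, Jmap]
    ring
  · intro x y z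
    simp [betaH_apply, bracket_eq_vec]
  · intro x y
    simp [betaH_apply, Jmap]
  · rw [alphaH, betaH, two_smul]
    abel
  · intro x y
    simp [alphaH_apply, betaH_apply, bracket_eq_vec]
    ring
  · rintro ⟨γ, hγ⟩
    have h := hγ (e 1) (e 3)
    have hb : bracket (e 1) (e 3) = 0 := by simp [bracket, e]
    rw [hb, map_zero, alphaH_apply] at h
    simp [e] at h
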